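/- Let F = {f_1,…,f_N} be an IFS of bi-Lipschitz contractions on a complete metric space with attractor K, and for an integer m ≥ 1 let F^m = {f_I : I ∈ {1,…,N}^m} (an IFS with the same attractor K). Then the post-critical sets of F and of F^m coincide: P_F = P_{F^m}. -/

import Mathlib

open Set Metric
open scoped ENNReal

/-- `wordMap f [i₁,…,i_k] = f i₁ ∘ ⋯ ∘ f i_k`. -/
def wordMap {X : Type*} {ι : Type*} (f : ι → X → X) : List ι → X → X
  | [] => id
  | i :: I => f i ∘ wordMap f I

/-- The prefix word `x₁ ⋯ x_n` of an infinite word `x`. -/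
def pre {ι : Type*} (x : ℕ → ι) (n : ℕ) : List ι := List.ofFn (fun j : Fin n => x j)

/-- `K` is the attractor of the IFS `f`: the (unique) nonempty compact set with
`K = ⋃ i, f i '' K`. -/
def IsAttractor {X : Type*} [MetricSpace X] {ι : Type*} (f : ι → X → X) (K : Set X) : Prop :=
  K.Nonempty ∧ IsCompact K ∧ K = ⋃ i, f i '' K

/-- `g` is a bi-Lipschitz contraction. -/
def IsBiLipContraction {X : Type*} [MetricSpace X] (g : X → X) : Prop :=
  ∃ A B : ℝ, 0 < A ∧ B < 1 ∧ ∀ x y : X,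
    A * dist x y ≤ dist (g x) (g y) ∧ dist (g x) (g y) ≤ B * dist x y

/-- `g` is a similitude of ratio `r`. -/
def IsSimilitude {X : Type*} [MetricSpace X] (g : X → X) (r : ℝ) : Prop :=
  ∀ x y : X, dist (g x) (g y) = r * dist x y

/-- The critical set `C_F = ⋃_{i ≠ j} f_i(K) ∩ f_j(K)`. -/
def criticalSet {X : Type*} {ι : Type*} (f : ι → X → X) (K : Set X) : Set X :=
  ⋃ (i : ι) (j : ι) (_ : i ≠ j), (f i '' K) ∩ (f j '' K)

/-- The post-critical set `P_F = ⋃_{ω ∈ Σ^*} f_ω⁻¹(C_F) ∩ K`. -/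
def postCriticalSet {X : Type*} {ι : Type*} (f : ι → X → X) (K : Set X) : Set X :=
  {p | p ∈ K ∧ ∃ I : List ι, I ≠ [] ∧ wordMap f I p ∈ criticalSet f K}

/-- `π` is the coding map of `(f, K)`: `{π x} = ⋂_k f_{x₁⋯x_k}(K)`. -/
def IsCodingMap {X : Type*} {ι : Type*} (f : ι → X → X) (K : Set X)
    (π : (ℕ → ι) → X) : Prop :=
  ∀ x : ℕ → ι, (⋂ k : ℕ, wordMap f (pre x (k + 1)) '' K) = {π x}

/-- Single intersection condition: `f_i(K) ∩ f_j(K)` contains at most one point for `i ≠ j`. -/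
def SIC {X : Type*} {ι : Type*} (f : ι → X → X) (K : Set X) : Prop :=
  ∀ i j : ι, i ≠ j → ((f i '' K) ∩ (f j '' K)).Subsingleton

/-- Angle separation condition with respect to a distance function `D`. -/
def ASCwrt {X : Type*} {ι : Type*} (f : ι → X → X) (K : Set X) (D : X → X → ℝ) : Prop :=
  ∃ c : ℝ, 0 < c ∧ ∀ i j : ι, i ≠ j → ∀ z : X, (f i '' K) ∩ (f j '' K) = {z} →
    ∀ x ∈ f i '' K, ∀ y ∈ f j '' K, c * max (D x z) (D y z) ≤ D x y

/-- Angle separation condition. -/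
def ASC {X : Type*} [MetricSpace X] {ι : Type*} (f : ι → X → X) (K : Set X) : Prop :=
  ASCwrt f K dist

/-- Lexicographic order on infinite words. -/
def lexLe {ι : Type*} [LinearOrder ι] (x y : ℕ → ι) : Prop :=
  x = y ∨ ∃ n : ℕ, (∀ k < n, x k = y k) ∧ x n < y n

/-- `Σ_K`: the set of lowest codings, i.e. of words that are lexicographically least
among all words with the same image under the coding map `π`. -/
def lowestCodings {X : Type*} {ι : Type*} [LinearOrder ι] (π : (ℕ → ι) → X) :
    Set (ℕ → ι) :=
  {x | ∀ y : ℕ → ι, π y = π x → lexLe x y}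

/-- `∂Σ_K`: the set of first letters of codings of post-critical points. -/
def bdryLetters {X : Type*} {ι : Type*} (f : ι → X → X) (K : Set X)
    (π : (ℕ → ι) → X) : Set ι :=
  {i | ∃ x : ℕ → ι, π x ∈ postCriticalSet f K ∧ x 0 = i}

/-- The contraction ratio `r_I = r_{i₁} ⋯ r_{i_k}` of a word. -/
def rword {ι : Type*} (r : ι → ℝ) (I : List ι) : ℝ := (I.map r).prod

theorem wordMap_append {X ι : Type*} (f : ι → X → X) (I J : List ι) :
    wordMap f (I ++ J) = wordMap f I ∘ wordMap f J := by
  induction I with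
  | nil => rfl
  | cons i I ih => simp only [List.cons_append, wordMap, ih, Function.comp_assoc]

theorem injective_wordMap {X ι : Type*} {f : ι → X → X} (hf : ∀ i, Function.Injective (f i))
    (I : List ι) : Function.Injective (wordMap f I) := by
  induction I with
  | nil => exact Function.injective_id
  | cons i I ih => exact (hf i).comp ih

theorem mapsTo_wordMap {X ι : Type*} {f : ι → X → X} {K : Set X} (hf : ∀ i, MapsTo (f i) K K)
    (I : List ι) : MapsTo (wordMap f I) K K := by
  induction I with
  | nil => exact mapsTo_id K
  | cons i I ih => exact (hf i).comp ih

theorem IsBiLipContraction.injective {X : Type*} [MetricSpace X] {g : X → X}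
    (hg : IsBiLipContraction g) : Function.Injective g := by
  obtain ⟨A, B, hA, -, h⟩ := hg
  intro x y hxy
  have hle := (h x y).1
  rw [hxy, dist_self] at hle
  exact dist_le_zero.1 (nonpos_of_mul_nonpos_right hle hA)

/-- Every point of a set covered by its images has a coding of each finite length. -/
theorem exists_length_eq_mem_image_wordMap {X ι : Type*} {f : ι → X → X} {K : Set X}
    (hK : K ⊆ ⋃ i, f i '' K) (k : ℕ) {x : X} (hx : x ∈ K) :
    ∃ I : List ι, I.length = k ∧ x ∈ wordMap f I '' K := by
  induction k generalizing x with
  | zero => exact ⟨[], rfl, x, hx, rfl⟩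
  | succ k ih =>
    obtain ⟨i, y, hy, rfl⟩ := mem_iUnion.1 (hK hx)
    obtain ⟨I, hI, z, hz, rfl⟩ := ih hy
    exact ⟨i :: I, by simp [hI], z, hz, rfl⟩

/-- Distinct words of the same length split after their longest common prefix. -/
theorem List.exists_eq_append_cons_of_ne {ι : Type*} {I J : List ι}
    (hl : I.length = J.length) (hne : I ≠ J) :
    ∃ (L : List ι) (i j : ι) (I' J' : List ι),
      i ≠ j ∧ I = L ++ i :: I' ∧ J = L ++ j :: J' := by
  induction I generalizing J with
  | nil => exact absurd (List.length_eq_zero_iff.1 hl.symm).symm hne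
  | cons a I ih =>
    obtain _ | ⟨b, J⟩ := J
    · simp at hl
    by_cases hab : a = b
    · subst hab
      obtain ⟨L, i, j, I', J', hij, rfl, rfl⟩ :=
        ih (by simpa using hl) (fun h => hne (by rw [h]))
      exact ⟨a :: L, i, j, I', J', hij, rfl, rfl⟩
    · exact ⟨[], a, b, I, J, hab, rfl, rfl⟩

theorem mem_criticalSet {X ι : Type*} {f : ι → X → X} {K : Set X} {x : X} :
    x ∈ criticalSet f K ↔ ∃ i j, i ≠ j ∧ x ∈ f i '' K ∧ x ∈ f j '' K := by
  simp only [criticalSet, mem_iUnion, mem_inter_iff, exists_prop]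

theorem mem_postCriticalSet_of_wordMap_mem_image {X ι : Type*} {f : ι → X → X} {K : Set X}
    (hinj : ∀ i, Function.Injective (f i)) (hmaps : ∀ i, MapsTo (f i) K K)
    {V I R : List ι} (hl : V.length = I.length) (hne : V ≠ I) {p : X} (hp : p ∈ K)
    (h : wordMap f (V ++ R) p ∈ wordMap f I '' K) : p ∈ postCriticalSet f K := by
  obtain ⟨L, v, i, V', I', hvi, rfl, rfl⟩ := List.exists_eq_append_cons_of_ne hl hne
  obtain ⟨q, hq, hqp⟩ := h
  rw [List.append_assoc, wordMap_append, wordMap_append] at hqp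
  have hz := injective_wordMap hinj L hqp
  refine ⟨hp, v :: V' ++ R, by simp, mem_criticalSet.2 ⟨v, i, hvi, ?_, ?_⟩⟩
  · exact ⟨_, mapsTo_wordMap hmaps (V' ++ R) hp, rfl⟩
  · exact ⟨_, mapsTo_wordMap hmaps I' hq, hz⟩

theorem wordMap_iterate {X ι : Type*} (f : ι → X → X) (m : ℕ) (W : List (Fin m → ι)) :
    wordMap (fun I : Fin m → ι => wordMap f (List.ofFn I)) W =
      wordMap f (W.flatMap List.ofFn) := by
  induction W with
  | nil => rfl
  | cons I W ih => simp only [wordMap, ih, List.flatMap_cons, wordMap_append]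

theorem List.exists_ofFn_eq_of_length_eq {ι : Type*} {m : ℕ} {I : List ι} (h : I.length = m) :
    ∃ J : Fin m → ι, List.ofFn J = I := by
  subst h
  exact ⟨I.get, List.ofFn_get I⟩

/-- A word whose length is a multiple of `m` is a concatenation of words of length `m`. -/
theorem List.exists_flatMap_ofFn_eq {ι : Type*} {m : ℕ} (k : ℕ) {I : List ι}
    (h : I.length = k * m) : ∃ W : List (Fin m → ι), W.flatMap List.ofFn = I := by
  induction k generalizing I with
  | zero => exact ⟨[], by simpa using h⟩
  | succ k ih =>
    rw [Nat.succ_mul] at h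
    obtain ⟨J, hJ⟩ := List.exists_ofFn_eq_of_length_eq
      (show (I.take m).length = m by rw [List.length_take]; omega)
    obtain ⟨W, hW⟩ := ih (show (I.drop m).length = k * m by rw [List.length_drop]; omega)
    exact ⟨J :: W, by rw [List.flatMap_cons, hJ, hW, List.take_append_drop]⟩

/-- Prepending a word `L` shorter than `m` sends the critical set of `F` into that of `F^m`. -/
theorem wordMap_mem_criticalSet_iterate {X ι : Type*} {f : ι → X → X} {K : Set X}
    (hK : K ⊆ ⋃ i, f i '' K) {m : ℕ} {L : List ι} (hL : L.length < m) {x : X}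
    (hx : x ∈ criticalSet f K) :
    wordMap f L x ∈ criticalSet (fun I : Fin m → ι => wordMap f (List.ofFn I)) K := by
  have extend : ∀ i, x ∈ f i '' K → ∃ (I' : List ι) (J : Fin m → ι),
      List.ofFn J = L ++ i :: I' ∧ wordMap f L x ∈ wordMap f (List.ofFn J) '' K := by
    rintro i ⟨a, ha, rfl⟩
    obtain ⟨I', hI', b, hb, rfl⟩ :=
      exists_length_eq_mem_image_wordMap hK (m - L.length - 1) ha
    obtain ⟨J, hJ⟩ := List.exists_ofFn_eq_of_length_eq
      (show (L ++ i :: I').length = m by simp [hI']; omega)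
    exact ⟨I', J, hJ, b, hb, by rw [hJ, wordMap_append]; rfl⟩
  obtain ⟨i, j, hij, hi, hj⟩ := mem_criticalSet.1 hx
  obtain ⟨I', I, hI, hxI⟩ := extend i hi
  obtain ⟨J', J, hJ, hxJ⟩ := extend j hj
  refine mem_criticalSet.2 ⟨I, J, ?_, hxI, hxJ⟩
  rintro rfl
  exact hij (List.cons.inj (List.append_cancel_left (hI.symm.trans hJ))).1

/-- **Lemma (Kigami).** For an IFS `F` of bi-Lipschitz contractions with attractor `K`
and `m ≥ 1`, the post-critical set of `F` equals that of the iterated IFS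
`F^m = {f_I : I ∈ Σ^m}` (indexed by the words `I : Fin m → Fin N`, with the same
attractor `K`). -/
theorem postCriticalSet_iterate
    {X : Type*} [MetricSpace X] [CompleteSpace X]
    {N : ℕ} (f : Fin N → X → X) (K : Set X)
    (hf : ∀ i, IsBiLipContraction (f i))
    (hK : IsAttractor f K)
    (m : ℕ) (hm : 1 ≤ m) :
    postCriticalSet f K =
      postCriticalSet (fun I : Fin m → Fin N => wordMap f (List.ofFn I)) K := by
  have hinj i := (hf i).injective
  have hcover : K ⊆ ⋃ i, f i '' K := hK.2.2.le
  have hmaps i : MapsTo (f i) K K := fun x hx => by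
    rw [hK.2.2]
    exact mem_iUnion.2 ⟨i, x, hx, rfl⟩
  ext p
  constructor
  · rintro ⟨hp, I, hI, hcrit⟩
    obtain ⟨i, -⟩ := mem_criticalSet.1 hcrit
    set L := List.replicate (m - 1 - (I.length + (m - 1)) % m) i with hL
    have hmod : (I.length + (m - 1)) % m < m := Nat.mod_lt _ hm
    have hlen : (L ++ I).length = (I.length + (m - 1)) / m * m := by
      have := Nat.div_add_mod' (I.length + (m - 1)) m
      rw [List.length_append, hL, List.length_replicate]
      omega
    obtain ⟨W, hW⟩ := List.exists_flatMap_ofFn_eq _ hlen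
    refine ⟨hp, W, ?_, ?_⟩
    · rintro rfl
      exact hI (List.append_eq_nil_iff.1 hW.symm).2
    · rw [wordMap_iterate, hW, wordMap_append]
      exact wordMap_mem_criticalSet_iterate hcover
        (by rw [hL, List.length_replicate]; omega) hcrit
  · rintro ⟨hp, W, hW, hcrit⟩
    obtain ⟨I, J, hIJ, hI, hJ⟩ := mem_criticalSet.1 hcrit
    obtain _ | ⟨V, W⟩ := W
    · exact absurd rfl hW
    rw [wordMap_iterate, List.flatMap_cons] at hI hJ
    by_cases hVI : V = I
    · subst hVI
      exact mem_postCriticalSet_of_wordMap_mem_image hinj hmaps (by simp)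
        (fun h => hIJ (List.ofFn_injective h)) hp hJ
    · exact mem_postCriticalSet_of_wordMap_mem_image hinj hmaps (by simp)
        (fun h => hVI (List.ofFn_injective h)) hp hI
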